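/- The asymptotic density of head normal forms among all λ-terms equals ρ/(1−ρ): the sequence Nat.card {t : Term // Hnf t ∧ size t = n} / L n (as real numbers) tends to ρ/(1−ρ) ≈ 0.41964337760707887 as n → ∞. -/

import Mathlib

inductive Term : Type
  | idx : ℕ → Term
  | app : Term → Term → Term
  | abs : Term → Term

def Term.size : Term → ℕ
  | .idx n => n + 1
  | .app t u => t.size + u.size + 1
  | .abs t => t.size + 1

noncomputable def L (n : ℕ) : ℕ := Nat.card {t : Term // t.size = n}

inductive Nhnf : Term → Prop
  | idx (n : ℕ) : Nhnf (.idx n)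
  | app {t : Term} (u : Term) : Nhnf t → Nhnf (.app t u)

inductive Hnf : Term → Prop
  | of {t : Term} : Nhnf t → Hnf t
  | abs {t : Term} : Hnf t → Hnf (.abs t)


open Finset

def termSuccEquiv (n : ℕ) : {t : Term // t.size = n + 1} ≃
    Unit ⊕ {t : Term // t.size = n} ⊕
      (Σ p : antidiagonal n, {t : Term // t.size = p.1.1} × {t : Term // t.size = p.1.2}) where
  toFun
    | ⟨.idx _, _⟩ => .inl ()
    | ⟨.abs t, h⟩ => .inr (.inl ⟨t, Nat.succ.inj h⟩)
    | ⟨.app t u, h⟩ => .inr (.inr ⟨⟨(t.size, u.size), mem_antidiagonal.2 (Nat.succ.inj h)⟩,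
        ⟨t, rfl⟩, ⟨u, rfl⟩⟩)
  invFun
    | .inl _ => ⟨.idx n, rfl⟩
    | .inr (.inl t) => ⟨.abs t.1, congrArg Nat.succ t.2⟩
    | .inr (.inr ⟨p, t, u⟩) => ⟨.app t.1 u.1, by
        rw [Term.size, t.2, u.2, mem_antidiagonal.1 p.2]⟩
  left_inv := by
    rintro ⟨t | ⟨t, u⟩ | t, h⟩
    · obtain rfl := Nat.succ.inj h
      rfl
    · rfl
    · rfl
  right_inv := by
    rintro (_ | ⟨t, h⟩ | ⟨⟨⟨i, j⟩, h⟩, ⟨t, ht⟩, ⟨u, hu⟩⟩)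
    · rfl
    · rfl
    · change t.size = i at ht
      change u.size = j at hu
      subst ht hu
      rfl

theorem Term.size_pos (t : Term) : 0 < t.size := by
  cases t <;> simp [Term.size]

instance finite_term_size (n : ℕ) : Finite {t : Term // t.size = n} := by
  induction n using Nat.strong_induction_on with
  | _ n ih =>
    cases n with
    | zero =>
      have : IsEmpty {t : Term // t.size = 0} := ⟨fun t => t.1.size_pos.ne' t.2⟩
      infer_instance
    | succ n =>
      have h : ∀ p : antidiagonal n,
          Finite ({t : Term // t.size = p.1.1} × {t : Term // t.size = p.1.2}) := fun p => by
        have := mem_antidiagonal.1 p.2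
        have := ih p.1.1 (by omega)
        have := ih p.1.2 (by omega)
        infer_instance
      have := ih n n.lt_succ_self
      exact Finite.of_equiv _ (termSuccEquiv n).symm

instance finite_term_size_of_pred (P : Term → Prop) (n : ℕ) :
    Finite {t : Term // P t ∧ t.size = n} :=
  Set.Finite.subset (s := {t : Term | t.size = n}) (finite_term_size n) fun _ h => h.2

theorem L_zero : L 0 = 0 := by
  have : IsEmpty {t : Term // t.size = 0} := ⟨fun t => t.1.size_pos.ne' t.2⟩
  exact Nat.card_of_isEmpty

theorem L_succ (n : ℕ) : L (n + 1) = 1 + L n + ∑ p ∈ antidiagonal n, L p.1 * L p.2 := by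
  rw [L, Nat.card_congr (termSuccEquiv n), Nat.card_sum, Nat.card_sum, Nat.card_sigma,
    Nat.card_unique, ← add_assoc]
  simp only [Nat.card_prod]
  exact congrArg _ (sum_coe_sort (antidiagonal n) fun p => L p.1 * L p.2)

/-- The number of neutral head normal forms of size `n`. -/
noncomputable def nhnfCount (n : ℕ) : ℕ := Nat.card {t : Term // Nhnf t ∧ t.size = n}

/-- The number of head normal forms of size `n`. -/
noncomputable def hnfCount (n : ℕ) : ℕ := Nat.card {t : Term // Hnf t ∧ t.size = n}

theorem not_nhnf_abs (t : Term) : ¬ Nhnf (.abs t) := nofun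

theorem nhnf_app_iff {t u : Term} : Nhnf (.app t u) ↔ Nhnf t :=
  ⟨fun | .app _ h => h, .app u⟩

theorem hnf_abs_iff {t : Term} : Hnf (.abs t) ↔ Hnf t :=
  ⟨fun | .abs h => h, .abs⟩

def nhnfSuccEquiv (n : ℕ) : {t : Term // Nhnf t ∧ t.size = n + 1} ≃
    Unit ⊕ (Σ p : antidiagonal n,
      {t : Term // Nhnf t ∧ t.size = p.1.1} × {t : Term // t.size = p.1.2}) where
  toFun
    | ⟨.idx _, _⟩ => .inl ()
    | ⟨.abs t, h⟩ => (not_nhnf_abs t h.1).elim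
    | ⟨.app t u, h⟩ => .inr ⟨⟨(t.size, u.size), mem_antidiagonal.2 (Nat.succ.inj h.2)⟩,
        ⟨t, nhnf_app_iff.1 h.1, rfl⟩, ⟨u, rfl⟩⟩
  invFun
    | .inl _ => ⟨.idx n, .idx n, rfl⟩
    | .inr ⟨p, t, u⟩ => ⟨.app t.1 u.1, .app _ t.2.1, by
        rw [Term.size, t.2.2, u.2, mem_antidiagonal.1 p.2]⟩
  left_inv := by
    rintro ⟨t | ⟨t, u⟩ | t, h⟩
    · obtain rfl := Nat.succ.inj h.2
      rfl
    · rfl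
    · exact (not_nhnf_abs t h.1).elim
  right_inv := by
    rintro (_ | ⟨⟨⟨i, j⟩, h⟩, ⟨t, hn, ht⟩, ⟨u, hu⟩⟩)
    · rfl
    · change t.size = i at ht
      change u.size = j at hu
      subst ht hu
      rfl

def hnfSuccEquiv (n : ℕ) : {t : Term // Hnf t ∧ t.size = n + 1} ≃
    {t : Term // Nhnf t ∧ t.size = n + 1} ⊕ {t : Term // Hnf t ∧ t.size = n} where
  toFun
    | ⟨.idx k, h⟩ => .inl ⟨.idx k, .idx k, h.2⟩
    | ⟨.abs t, h⟩ => .inr ⟨t, hnf_abs_iff.1 h.1, Nat.succ.inj h.2⟩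
    | ⟨.app t u, h⟩ => .inl ⟨.app t u, match h.1 with | .of h => h, h.2⟩
  invFun
    | .inl t => ⟨t.1, .of t.2.1, t.2.2⟩
    | .inr t => ⟨.abs t.1, .abs t.2.1, congrArg Nat.succ t.2.2⟩
  left_inv := by rintro ⟨t | ⟨t, u⟩ | t, h⟩ <;> rfl
  right_inv := by
    rintro (⟨t | ⟨t, u⟩ | t, h⟩ | t)
    · rfl
    · rfl
    · exact (not_nhnf_abs t h.1).elim
    · rfl

theorem nhnfCount_zero : nhnfCount 0 = 0 := by
  have : IsEmpty {t : Term // Nhnf t ∧ t.size = 0} := ⟨fun t => t.1.size_pos.ne' t.2.2⟩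
  exact Nat.card_of_isEmpty

theorem hnfCount_zero : hnfCount 0 = 0 := by
  have : IsEmpty {t : Term // Hnf t ∧ t.size = 0} := ⟨fun t => t.1.size_pos.ne' t.2.2⟩
  exact Nat.card_of_isEmpty

theorem nhnfCount_succ (n : ℕ) :
    nhnfCount (n + 1) = 1 + ∑ p ∈ antidiagonal n, nhnfCount p.1 * L p.2 := by
  rw [nhnfCount, Nat.card_congr (nhnfSuccEquiv n), Nat.card_sum, Nat.card_sigma,
    Nat.card_unique]
  simp only [Nat.card_prod]
  exact congrArg _ (sum_coe_sort (antidiagonal n) fun p => nhnfCount p.1 * L p.2)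

theorem hnfCount_succ (n : ℕ) : hnfCount (n + 1) = nhnfCount (n + 1) + hnfCount n := by
  rw [hnfCount, Nat.card_congr (hnfSuccEquiv n), Nat.card_sum, nhnfCount, hnfCount]

theorem L_one : L 1 = 1 := by simp [L_succ, L_zero]

theorem nhnfCount_one : nhnfCount 1 = 1 := by simp [nhnfCount_succ, nhnfCount_zero]

theorem hnfCount_one : hnfCount 1 = 1 := by
  rw [hnfCount_succ, hnfCount_zero, nhnfCount_one]

/-- Neutral head normal forms of size `n + 2` are equinumerous with terms of size `n + 1`. -/
theorem nhnfCount_add_two (n : ℕ) : nhnfCount (n + 2) = L (n + 1) := by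
  induction n using Nat.strong_induction_on with
  | _ n ih =>
    rw [nhnfCount_succ, L_succ, Finset.Nat.sum_antidiagonal_succ, nhnfCount_zero, zero_mul, zero_add,
      add_assoc]
    cases n with
    | zero => simp [nhnfCount_one, L_zero]
    | succ n =>
      rw [Nat.sum_antidiagonal_succ, Finset.Nat.sum_antidiagonal_succ, nhnfCount_one, L_zero, zero_mul,
        zero_add, one_mul]
      simp only [zero_add]
      congr 2
      refine Finset.sum_congr rfl fun p hp => ?_
      rw [ih p.1 (by have := mem_antidiagonal.1 hp; omega)]

section GeneratingFunction

open PowerSeries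

/-- The generating function of λ-terms counted by size. -/
noncomputable def termSeries : ℝ⟦X⟧ := PowerSeries.mk fun n => (L n : ℝ)

theorem termSeries_eq :
    (1 - X) * termSeries = X + X * (1 - X) * termSeries + X * (1 - X) * termSeries ^ 2 := by
  have h : termSeries = X * PowerSeries.mk 1 + X * termSeries + X * termSeries ^ 2 := by
    ext n
    cases n with
    | zero => simp [termSeries, L_zero]
    | succ n => simp [termSeries, L_succ, sq, coeff_succ_X_mul, coeff_mul _ (mk _)]
  have h1 : PowerSeries.mk 1 * (1 - X : ℝ⟦X⟧) = 1 := PowerSeries.mk_one_mul_one_sub_eq_one ℝ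
  linear_combination (1 - X) * h + X * h1

theorem discriminant_ode (Y : ℝ⟦X⟧) (hY : (1 - X) * Y ^ 2 = 1 - 3 * X - X ^ 2 - X ^ 3) :
    (1 - 4 * X + 2 * X ^ 2 + X ^ 4) * d⁄dX ℝ Y = (X ^ 3 - X ^ 2 - X - 1) * Y := by
  have hY0 : Y ≠ 0 := by
    rintro rfl
    simpa using congrArg constantCoeff hY
  have h3 : d⁄dX ℝ (3 : ℝ⟦X⟧) = 0 := (d⁄dX ℝ).map_natCast 3
  have hd := congrArg (d⁄dX ℝ) hY
  simp only [Derivation.leibniz, Derivation.leibniz_pow, map_sub, derivative_X, h3,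
    Derivation.map_one_eq_zero, smul_eq_mul, nsmul_eq_mul] at hd
  norm_num at hd
  have h2 : (2 : ℝ⟦X⟧) ≠ 0 := (map_ne_zero_iff C C_injective).2 (two_ne_zero (α := ℝ))
  apply mul_left_cancel₀ (mul_ne_zero h2 hY0)
  linear_combination (1 - 3 * X - X ^ 2 - X ^ 3) * hd + (3 + 2 * X + 3 * X ^ 2) * hY

theorem termSeries_ode :
    (1 - 4 * X + 2 * X ^ 2 + X ^ 4) * d⁄dX ℝ (1 - X - 2 * X * termSeries) =
      (X ^ 3 - X ^ 2 - X - 1) * (1 - X - 2 * X * termSeries) :=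
  discriminant_ode _ (by linear_combination -4 * X * termSeries_eq)

theorem L_recurrence (m : ℕ) :
    (m + 5 : ℝ) * L (m + 4) + (2 * m + 7) * L (m + 2) + L (m + 1) + m * L m =
      (4 * m + 15) * L (m + 3) := by
  obtain ⟨Y, hY⟩ : ∃ Y, 1 - X - 2 * X * termSeries = Y := ⟨_, rfl⟩
  have hcoeff (k : ℕ) : coeff (k + 2) Y = -2 * L (k + 1) := by
    have h2 : (2 : ℝ⟦X⟧) = C 2 := rfl
    rw [← hY, h2, mul_assoc]
    simp [coeff_succ_X_mul, termSeries, coeff_one, coeff_X]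
  have h := termSeries_ode
  rw [hY] at h
  have h' : d⁄dX ℝ Y + X * (X * (C 2 * d⁄dX ℝ Y + X * (X * d⁄dX ℝ Y))) + X * (X * Y) + X * Y + Y =
      X * (C 4 * d⁄dX ℝ Y) + X * (X * (X * Y)) := by
    have h2 : (C 2 : ℝ⟦X⟧) = 2 := rfl
    have h4 : (C 4 : ℝ⟦X⟧) = 4 := rfl
    rw [h2, h4]
    linear_combination h
  have hc := congrArg (coeff (m + 4)) h'
  simp only [map_add, coeff_succ_X_mul, coeff_C_mul, coeff_derivative, hcoeff,
    show m + 4 = m + 2 + 2 from rfl, show m + 3 = m + 1 + 2 from rfl,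
    show m + 2 + 2 + 1 = m + 3 + 2 from rfl] at hc
  cases m with
  | zero =>
    norm_num at hc ⊢
    linarith
  | succ m =>
    rw [hcoeff m] at hc
    push_cast at hc ⊢
    linear_combination -hc / 2

end GeneratingFunction

theorem L_two : L 2 = 2 := by simp [L_succ, L_zero, Finset.Nat.antidiagonal_succ]

theorem L_three : L 3 = 4 := by simp [L_succ, L_zero, Finset.Nat.antidiagonal_succ]

theorem L_pos (n : ℕ) : 0 < L (n + 1) := by
  rw [L_succ]
  omega

theorem two_mul_L_le (n : ℕ) : 2 * (L n : ℝ) ≤ L (n + 1) := by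
  induction n using Nat.strong_induction_on with
  | _ n ih =>
    match n with
    | 0 => simp [L_zero, L_one]
    | 1 => simp [L_one, L_two]
    | 2 => norm_num [L_two, L_three]
    | m + 3 =>
      have h₀ := ih m (by omega)
      have h₁ := ih (m + 1) (by omega)
      have h₂ := ih (m + 2) (by omega)
      simp only [add_assoc, Nat.reduceAdd] at h₀ h₁ h₂ ⊢
      have hm : (0 : ℝ) ≤ m := m.cast_nonneg
      have h₃ : (0 : ℝ) ≤ L (m + 3) := Nat.cast_nonneg _
      have hrec := L_recurrence m
      have e₀ : (m : ℝ) * L m ≤ m * (L (m + 3) / 8) := by gcongr; linarith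
      have e₂ : (2 * m + 7 : ℝ) * L (m + 2) ≤ (2 * m + 7) * (L (m + 3) / 2) := by
        gcongr; linarith
      refine le_of_mul_le_mul_left ?_ (by positivity : (0 : ℝ) < m + 5)
      nlinarith [mul_nonneg hm h₃]

/-- The ratio of the numbers of terms of consecutive sizes. -/
noncomputable def sizeRatio (n : ℕ) : ℝ := L n / L (n + 1)

theorem sizeRatio_nonneg (n : ℕ) : 0 ≤ sizeRatio n := by
  unfold sizeRatio; positivity

theorem sizeRatio_le_half (n : ℕ) : sizeRatio n ≤ 1 / 2 := by
  have h : (0 : ℝ) < L (n + 1) := by exact_mod_cast L_pos n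
  rw [sizeRatio, div_le_iff₀ h]
  linarith [two_mul_L_le n]

theorem L_eq_sizeRatio_mul (n : ℕ) : (L n : ℝ) = sizeRatio n * L (n + 1) := by
  have h : (L (n + 1) : ℝ) ≠ 0 := by exact_mod_cast (L_pos n).ne'
  rw [sizeRatio, div_mul_cancel₀ _ h]

theorem sizeRatio_recurrence (m : ℕ) :
    (m + 5 : ℝ) = sizeRatio (m + 3) * (4 * m + 15 - (2 * m + 7) * sizeRatio (m + 2)
      - sizeRatio (m + 2) * sizeRatio (m + 1)
      - m * (sizeRatio (m + 2) * sizeRatio (m + 1) * sizeRatio m)) := by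
  have h : (L (m + 4) : ℝ) ≠ 0 := by exact_mod_cast (L_pos (m + 3)).ne'
  have hrec := L_recurrence m
  have h₀ := L_eq_sizeRatio_mul m
  have h₁ := L_eq_sizeRatio_mul (m + 1)
  have h₂ := L_eq_sizeRatio_mul (m + 2)
  have h₃ := L_eq_sizeRatio_mul (m + 3)
  simp only [add_assoc, Nat.reduceAdd] at h₀ h₁ h₂ h₃
  rw [h₀, h₁, h₂, h₃] at hrec
  apply mul_right_cancel₀ h
  linear_combination hrec

section Limit

variable {ρ : ℝ}

theorem root_le (hρ : 0 < ρ) (hroot : ρ ^ 3 + ρ ^ 2 + 3 * ρ = 1) : ρ ≤ 3 / 10 := by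
  by_contra! h
  nlinarith [pow_pos hρ 3]

theorem abs_recurrence_step_le (hρ : 0 < ρ) (hroot : ρ ^ 3 + ρ ^ 2 + 3 * ρ = 1)
    {m u v w x : ℝ} (hm : 0 ≤ m) (hu : 0 ≤ u) (hu' : u ≤ 1 / 2) (hv : 0 ≤ v) (hv' : v ≤ 1 / 2)
    (hw : 0 ≤ w) (hw' : w ≤ 1 / 2) (hx : 0 ≤ x) (hx' : x ≤ 1 / 2)
    (hrec : m + 5 = x * (4 * m + 15 - (2 * m + 7) * w - w * v - m * (w * v * u)))
    (hdu : |u - ρ| ≤ 4 / (m + 5)) (hdv : |v - ρ| ≤ 4 / (m + 5)) (hdw : |w - ρ| ≤ 4 / (m + 5)) :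
    |x - ρ| ≤ 4 / (m + 8) := by
  have hρ' := root_le hρ hroot
  set q := 4 / (m + 5) with hq
  have hq0 : 0 < q := by positivity
  have hqm : q * (m + 5) = 4 := by rw [hq]; field_simp
  have hprod : |w * v * u - ρ ^ 3| ≤ q / 2 := by
    have e : w * v * u - ρ ^ 3 = (w - ρ) * (v * u) + (v - ρ) * (ρ * u) + (u - ρ) * (ρ * ρ) := by
      ring
    have h₁ : v * u ≤ 1 / 2 * (1 / 2) := by gcongr
    have h₂ : ρ * u ≤ 3 / 10 * (1 / 2) := by gcongr
    have h₃ : ρ * ρ ≤ 3 / 10 * (3 / 10) := by gcongr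
    rw [e]
    calc _ ≤ |w - ρ| * (v * u) + |v - ρ| * (ρ * u) + |u - ρ| * (ρ * ρ) := by
          refine (abs_add_three _ _ _).trans_eq ?_
          rw [abs_mul _ (v * u), abs_mul _ (ρ * u), abs_mul _ (ρ * ρ), abs_of_nonneg (mul_nonneg hv hu),
            abs_of_nonneg (mul_nonneg hρ.le hu), abs_of_nonneg (mul_nonneg hρ.le hρ.le)]
      _ ≤ q * (1 / 2 * (1 / 2)) + q * (3 / 10 * (1 / 2)) + q * (3 / 10 * (3 / 10)) := by gcongr
      _ ≤ q / 2 := by linarith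
  have hconst : |3 * ρ + 5 * ρ ^ 3 - w * v - 5| ≤ 6 := by
    have h₁ : w * v ≤ 1 / 2 * (1 / 2) := by gcongr
    have h₂ : ρ ^ 3 ≤ (3 / 10) ^ 3 := by gcongr
    have h₃ := pow_pos hρ 3
    have h₄ := mul_nonneg hw hv
    rw [abs_le]
    constructor <;> linarith
  have hid : (m + 5) * (x - ρ) = (x * ρ) * (m * (w * v * u - ρ ^ 3) + (2 * m + 7) * (w - ρ)
      - (3 * ρ + 5 * ρ ^ 3 - w * v - 5)) := by
    linear_combination (-ρ) * hrec - x * (m + 5) * (1 - ρ) * hroot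
  have hbound : (m + 5) * |x - ρ| ≤ 1 / 2 * (3 / 10) * 16 := by
    have h := congrArg abs hid
    rw [abs_mul, abs_of_pos (by positivity : 0 < m + 5), abs_mul,
      abs_of_nonneg (mul_nonneg hx hρ.le)] at h
    rw [h]
    gcongr
    calc _ ≤ |m * (w * v * u - ρ ^ 3)| + |(2 * m + 7) * (w - ρ)|
          + |3 * ρ + 5 * ρ ^ 3 - w * v - 5| :=
          (abs_sub _ _).trans (add_le_add_left (abs_add_le _ _) _)
      _ ≤ m * (q / 2) + (2 * m + 7) * q + 6 := by
          rw [abs_mul, abs_mul, abs_of_nonneg hm, abs_of_nonneg (by positivity : 0 ≤ 2 * m + 7)]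
          gcongr
      _ ≤ 16 := by nlinarith
  rw [le_div_iff₀ (by positivity)]
  nlinarith [abs_nonneg (x - ρ)]

theorem abs_sizeRatio_sub_le (hρ : 0 < ρ) (hroot : ρ ^ 3 + ρ ^ 2 + 3 * ρ = 1) (n : ℕ) :
    |sizeRatio n - ρ| ≤ 4 / (n + 5) := by
  induction n using Nat.strong_induction_on with
  | _ n ih =>
    match n with
    | m + 3 =>
      have hm : (0 : ℝ) ≤ m := m.cast_nonneg
      have hle : ∀ k : ℝ, 0 ≤ k → (4 : ℝ) / (m + k + 5) ≤ 4 / (m + 5) := fun k hk => by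
        gcongr; linarith
      have h₁ := ih (m + 1) (by omega)
      have h₂ := ih (m + 2) (by omega)
      push_cast at h₁ h₂ ⊢
      have := abs_recurrence_step_le hρ hroot hm (sizeRatio_nonneg m) (sizeRatio_le_half m)
        (sizeRatio_nonneg (m + 1)) (sizeRatio_le_half (m + 1))
        (sizeRatio_nonneg (m + 2)) (sizeRatio_le_half (m + 2))
        (sizeRatio_nonneg (m + 3)) (sizeRatio_le_half (m + 3)) (sizeRatio_recurrence m)
        (ih m (by omega)) (h₁.trans (hle 1 (by norm_num))) (h₂.trans (hle 2 (by norm_num)))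
      convert this using 2
      ring
    | 0 | 1 | 2 =>
      have hρ' := root_le hρ hroot
      have h (k : ℕ) : |sizeRatio k - ρ| ≤ 1 / 2 := abs_le.2
        ⟨by linarith [sizeRatio_nonneg k], by linarith [sizeRatio_le_half k]⟩
      refine (h _).trans ?_
      norm_num

theorem hnf_ratio_succ (n : ℕ) : (hnfCount (n + 2) : ℝ) / L (n + 2) =
    sizeRatio (n + 1) * (1 + hnfCount (n + 1) / L (n + 1)) := by
  have h₁ : (L (n + 1) : ℝ) ≠ 0 := by exact_mod_cast (L_pos n).ne'
  have h₂ : (L (n + 2) : ℝ) ≠ 0 := by exact_mod_cast (L_pos (n + 1)).ne'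
  rw [hnfCount_succ, nhnfCount_add_two, sizeRatio]
  push_cast
  field_simp

theorem abs_hnf_ratio_sub_le (hρ : 0 < ρ) (hroot : ρ ^ 3 + ρ ^ 2 + 3 * ρ = 1) (n : ℕ) :
    |(hnfCount (n + 1) : ℝ) / L (n + 1) - ρ / (1 - ρ)| ≤ 24 / (n + 6) := by
  have hρ' := root_le hρ hroot
  have hne : 1 - ρ ≠ 0 := by linarith
  obtain ⟨s, hs⟩ : ∃ s, ρ / (1 - ρ) = s := ⟨_, rfl⟩
  have hs0 : 0 ≤ s := hs ▸ div_nonneg hρ.le (by linarith)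
  have hs1 : s ≤ 1 := by
    rw [← hs, div_le_one (by linarith)]
    linarith
  have hsρ : s = ρ * (1 + s) := by
    rw [← hs]
    field_simp
    ring
  rw [hs]
  induction n with
  | zero =>
    rw [hnfCount_one, L_one, abs_le]
    norm_num
    constructor <;> linarith
  | succ n ih =>
    rw [hnf_ratio_succ]
    obtain ⟨h, hh⟩ : ∃ h, (hnfCount (n + 1) : ℝ) / L (n + 1) = h := ⟨_, rfl⟩
    rw [hh] at ih ⊢
    have hr := abs_sizeRatio_sub_le hρ hroot (n + 1)
    have h0 := sizeRatio_nonneg (n + 1)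
    have h1 := sizeRatio_le_half (n + 1)
    push_cast at hr ⊢
    rw [show (n : ℝ) + 1 + 5 = n + 6 by ring] at hr
    have e : sizeRatio (n + 1) * (1 + h) - s =
        sizeRatio (n + 1) * (h - s) + (sizeRatio (n + 1) - ρ) * (1 + s) := by
      linear_combination -hsρ
    rw [e]
    calc _ ≤ sizeRatio (n + 1) * |h - s| + |sizeRatio (n + 1) - ρ| * (1 + s) := by
          refine (abs_add_le _ _).trans_eq ?_
          rw [abs_mul, abs_mul, abs_of_nonneg h0, abs_of_nonneg (by linarith : 0 ≤ 1 + s)]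
      _ ≤ 1 / 2 * (24 / (n + 6)) + 4 / (n + 6) * (1 + 1) := by gcongr
      _ = 20 / (n + 6) := by ring
      _ ≤ 24 / (n + 1 + 6) := by
          rw [div_le_div_iff₀ (by positivity) (by positivity)]
          linarith [(n.cast_nonneg : (0 : ℝ) ≤ n)]

end Limit

theorem hnf_density (ρ : ℝ) (hρ : ρ ∈ Set.Ioo (0 : ℝ) 1)
    (hroot : ρ ^ 3 + ρ ^ 2 + 3 * ρ = 1) :
    Filter.Tendsto
      (fun n : ℕ =>
        (Nat.card {t : Term // Hnf t ∧ t.size = n} : ℝ) / (L n : ℝ))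
      Filter.atTop (nhds (ρ / (1 - ρ))) := by
  rw [← Filter.tendsto_add_atTop_iff_nat 1, tendsto_iff_dist_tendsto_zero]
  refine squeeze_zero (fun _ => dist_nonneg) (abs_hnf_ratio_sub_le hρ.1 hroot) ?_
  exact tendsto_const_nhds.div_atTop
    (Filter.tendsto_atTop_add_const_right _ _ tendsto_natCast_atTop_atTop)
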